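/- arXiv:1802.03138 — 2 statements merged into one kernel-verified Lean document; each statement's English description precedes it below -/
import Mathlib

section
/- Let f, g and h be entire functions given by everywhere absolutely convergent vector valued Dirichlet series, and let p ≥ 0, q ≥ 0, m ≥ 0 be integers. Assume f is of regular relative (m,q) Ritt growth with respect to h with 0 < λ_h^{(m,q)}(f) = ρ_h^{(m,q)}(f) < +∞, and g is of regular relative (m,p) Ritt growth with respect to h with 0 < λ_h^{(m,p)}(g) = ρ_h^{(m,p)}(g) < +∞. Then λ_g^{(p,q)}(f) = ρ_g^{(p,q)}(f) = ρ_h^{(m,q)}(f)/ρ_h^{(m,p)}(g). -/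
open Filter Topology

noncomputable section

/-- An entire function given by an everywhere absolutely convergent
vector valued Dirichlet series, with coefficients in a Banach space `E`. -/
structure VVDS (E : Type*) [NormedAddCommGroup E] [NormedSpace ℂ E] [CompleteSpace E] where
  a : ℕ → E
  lam : ℕ → ℝ
  lam_pos : ∀ n, 0 < lam n
  lam_strictMono : StrictMono lam
  lam_tendsto : Tendsto lam atTop atTop
  log_index_bound : ∃ D : ℝ, ∀ᶠ n : ℕ in atTop, Real.log (n : ℝ) / lam n ≤ D
  coeff_decay : Tendsto (fun n => Real.log ‖a n‖ / lam n) atTop atBot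
  abs_conv : ∀ s : ℂ, Summable (fun n => Real.exp (s.re * lam n) * ‖a n‖)

variable {E F G : Type*} [NormedAddCommGroup E] [NormedSpace ℂ E] [CompleteSpace E]
  [NormedAddCommGroup F] [NormedSpace ℂ F] [CompleteSpace F]
  [NormedAddCommGroup G] [NormedSpace ℂ G] [CompleteSpace G]

/-- The entire function defined by the vector valued Dirichlet series. -/
def VVDS.toFun (f : VVDS E) (s : ℂ) : E := ∑' n, Complex.exp (s * (f.lam n : ℂ)) • f.a n

/-- The maximum modulus function `M_f(σ) = sup_t ‖f(σ+it)‖`. -/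
def VVDS.M (f : VVDS E) (σ : ℝ) : ℝ := ⨆ t : ℝ, ‖f.toFun ((σ : ℂ) + (t : ℂ) * Complex.I)‖

/-- The inverse function of the maximum modulus function. -/
def VVDS.Minv (f : VVDS E) (y : ℝ) : ℝ := sInf {σ : ℝ | y ≤ f.M σ}

/-- The (p,q)-th relative Ritt order of `f` with respect to `g`. -/
def relRittOrder (p q : ℕ) (f : VVDS E) (g : VVDS F) : EReal :=
  limsup (fun σ : ℝ =>
    ((Real.log^[p] (g.Minv (f.M σ)) / Real.log^[q] σ : ℝ) : EReal)) atTop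

/-- The (p,q)-th relative Ritt lower order of `f` with respect to `g`. -/
def relRittLowerOrder (p q : ℕ) (f : VVDS E) (g : VVDS F) : EReal :=
  liminf (fun σ : ℝ =>
    ((Real.log^[p] (g.Minv (f.M σ)) / Real.log^[q] σ : ℝ) : EReal)) atTop

/-- The (p,q)-th relative Ritt type of `f` with respect to `g`. -/
def relRittType (p q : ℕ) (f : VVDS E) (g : VVDS F) : EReal :=
  limsup (fun σ : ℝ =>
    ((Real.log^[p-1] (g.Minv (f.M σ)) /
      (Real.log^[q-1] σ) ^ (relRittOrder p q f g).toReal : ℝ) : EReal)) atTop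

/-- The (p,q)-th relative Ritt lower type of `f` with respect to `g`. -/
def relRittLowerType (p q : ℕ) (f : VVDS E) (g : VVDS F) : EReal :=
  liminf (fun σ : ℝ =>
    ((Real.log^[p-1] (g.Minv (f.M σ)) /
      (Real.log^[q-1] σ) ^ (relRittOrder p q f g).toReal : ℝ) : EReal)) atTop

/-- The (p,q)-th relative Ritt weak type of `f` with respect to `g`. -/
def relRittWeakType (p q : ℕ) (f : VVDS E) (g : VVDS F) : EReal :=
  liminf (fun σ : ℝ =>
    ((Real.log^[p-1] (g.Minv (f.M σ)) /
      (Real.log^[q-1] σ) ^ (relRittLowerOrder p q f g).toReal : ℝ) : EReal)) atTop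

/-- The growth indicator `τ̄_g^{(p,q)}(f)`. -/
def relRittUpperWeakType (p q : ℕ) (f : VVDS E) (g : VVDS F) : EReal :=
  limsup (fun σ : ℝ =>
    ((Real.log^[p-1] (g.Minv (f.M σ)) /
      (Real.log^[q-1] σ) ^ (relRittLowerOrder p q f g).toReal : ℝ) : EReal)) atTop

lemma VVDS.norm_term (f : VVDS E) (σ t : ℝ) (n : ℕ) :
    ‖Complex.exp (((σ : ℂ) + (t : ℂ) * Complex.I) * (f.lam n : ℂ)) • f.a n‖
      = Real.exp (σ * f.lam n) * ‖f.a n‖ := by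
  rw [norm_smul, Complex.norm_exp]
  simp

lemma VVDS.summable_real (f : VVDS E) (σ : ℝ) :
    Summable (fun n => Real.exp (σ * f.lam n) * ‖f.a n‖) := by
  simpa using f.abs_conv (σ : ℂ)

lemma VVDS.summable_term (f : VVDS E) (σ t : ℝ) :
    Summable (fun n => Complex.exp (((σ : ℂ) + (t : ℂ) * Complex.I) * (f.lam n : ℂ)) • f.a n) := by
  apply Summable.of_norm
  simp only [f.norm_term]
  exact f.summable_real σ

/-- The majorant series. -/
def VVDS.S (f : VVDS E) (σ : ℝ) : ℝ := ∑' n, Real.exp (σ * f.lam n) * ‖f.a n‖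

lemma VVDS.S_mono (f : VVDS E) : Monotone f.S := by
  intro x y hxy
  refine (f.summable_real x).tsum_le_tsum (fun n => ?_) (f.summable_real y)
  have := (f.lam_pos n).le
  gcongr

lemma VVDS.norm_le_S (f : VVDS E) (σ t : ℝ) :
    ‖f.toFun ((σ : ℂ) + (t : ℂ) * Complex.I)‖ ≤ f.S σ := by
  unfold VVDS.toFun VVDS.S
  refine tsum_of_norm_bounded (f.summable_real σ).hasSum (fun n => ?_)
  rw [f.norm_term]

lemma VVDS.bdd (f : VVDS E) (σ : ℝ) :
    BddAbove (Set.range fun t : ℝ => ‖f.toFun ((σ : ℂ) + (t : ℂ) * Complex.I)‖) :=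
  ⟨f.S σ, by rintro _ ⟨t, rfl⟩; exact f.norm_le_S σ t⟩

lemma VVDS.norm_le_M (f : VVDS E) (σ t : ℝ) :
    ‖f.toFun ((σ : ℂ) + (t : ℂ) * Complex.I)‖ ≤ f.M σ := le_ciSup (f.bdd σ) t

lemma VVDS.M_le_S (f : VVDS E) (σ : ℝ) : f.M σ ≤ f.S σ := ciSup_le (f.norm_le_S σ)

/-- Termwise majorant of the difference on two vertical lines. -/
def VVDS.D (f : VVDS E) (x y : ℝ) : ℝ :=
  ∑' n, |Real.exp (x * f.lam n) - Real.exp (y * f.lam n)| * ‖f.a n‖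

lemma VVDS.summable_D (f : VVDS E) (x y : ℝ) :
    Summable fun n => |Real.exp (x * f.lam n) - Real.exp (y * f.lam n)| * ‖f.a n‖ := by
  refine Summable.of_nonneg_of_le (fun n => by positivity) (fun n => ?_)
    ((f.summable_real x).add (f.summable_real y))
  rw [← add_mul]
  gcongr
  refine (abs_sub _ _).trans ?_
  simp

lemma VVDS.M_le_add (f : VVDS E) (x y : ℝ) : f.M x ≤ f.M y + f.D x y := by
  refine ciSup_le (fun t => ?_)
  have h1 : ‖f.toFun ((x : ℂ) + (t : ℂ) * Complex.I) - f.toFun ((y : ℂ) + (t : ℂ) * Complex.I)‖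
      ≤ f.D x y := by
    unfold VVDS.toFun VVDS.D
    rw [← (f.summable_term x t).tsum_sub (f.summable_term y t)]
    refine tsum_of_norm_bounded (f.summable_D x y).hasSum (fun n => ?_)
    rw [← sub_smul, norm_smul]
    apply le_of_eq
    congr 1
    have : Complex.exp (((x : ℂ) + (t : ℂ) * Complex.I) * (f.lam n : ℂ)) -
        Complex.exp (((y : ℂ) + (t : ℂ) * Complex.I) * (f.lam n : ℂ)) =
        ((Real.exp (x * f.lam n) - Real.exp (y * f.lam n) : ℝ) : ℂ) *
          Complex.exp ((t * f.lam n : ℝ) * Complex.I) := by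
      push_cast
      rw [sub_mul, ← Complex.exp_add, ← Complex.exp_add]
      congr 2 <;> ring
    rw [this, norm_mul, Complex.norm_exp_ofReal_mul_I, mul_one, Complex.norm_real, Real.norm_eq_abs]
  have h2 := norm_le_insert' (f.toFun ((x : ℂ) + (t : ℂ) * Complex.I))
    (f.toFun ((y : ℂ) + (t : ℂ) * Complex.I))
  linarith [f.norm_le_M y t]

lemma VVDS.D_comm (f : VVDS E) (x y : ℝ) : f.D x y = f.D y x := by
  unfold VVDS.D
  simp only [abs_sub_comm]

lemma VVDS.D_tendsto (f : VVDS E) (y : ℝ) : Tendsto (fun x => f.D x y) (𝓝 y) (𝓝 0) := by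
  have h0 : (∑' n : ℕ, |Real.exp (y * f.lam n) - Real.exp (y * f.lam n)| * ‖f.a n‖) = 0 := by simp
  rw [← h0]
  unfold VVDS.D
  refine tendsto_tsum_of_dominated_convergence
    (bound := fun n => Real.exp ((y+1) * f.lam n) * ‖f.a n‖ + Real.exp (y * f.lam n) * ‖f.a n‖)
    ((f.summable_real (y+1)).add (f.summable_real y)) (fun n => ?_) ?_
  · apply Continuous.tendsto (f := fun x => |Real.exp (x * f.lam n) - Real.exp (y * f.lam n)| * ‖f.a n‖)
    fun_prop
  · filter_upwards [Iio_mem_nhds (show y < y + 1 by linarith)] with x hx n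
    have hx' : x ≤ y + 1 := le_of_lt hx
    have := (f.lam_pos n).le
    rw [Real.norm_eq_abs, abs_of_nonneg (by positivity), ← add_mul]
    gcongr
    refine (abs_sub _ _).trans ?_
    simp only [Real.abs_exp]
    gcongr

lemma VVDS.M_continuous (f : VVDS E) : Continuous f.M := by
  rw [continuous_iff_continuousAt]
  intro y
  unfold ContinuousAt
  rw [tendsto_iff_dist_tendsto_zero]
  refine squeeze_zero (fun _ => dist_nonneg) (fun x => ?_) (f.D_tendsto y)
  rw [Real.dist_eq, abs_le]
  have h1 := f.M_le_add x y
  have h2 := f.M_le_add y x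
  rw [f.D_comm y x] at h2
  constructor <;> linarith

lemma mean_geom_tendsto (z : ℂ) (hz : ‖z‖ = 1) (h1 : z ≠ 1) :
    Tendsto (fun N : ℕ => (N : ℂ)⁻¹ * ∑ k ∈ Finset.range N, z ^ k) atTop (𝓝 0) := by
  have hlim : Tendsto (fun N : ℕ => (N : ℝ)⁻¹ * (2 / ‖z - 1‖)) atTop (𝓝 0) := by
    simpa using (tendsto_inv_atTop_nhds_zero_nat (𝕜 := ℝ)).mul_const (2 / ‖z - 1‖)
  refine squeeze_zero_norm (fun N => ?_) hlim
  rw [norm_mul, norm_inv, Complex.norm_natCast, geom_sum_eq h1, norm_div]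
  gcongr
  refine (norm_sub_le _ _).trans ?_
  rw [norm_pow, hz]
  norm_num

lemma VVDS.exists_delta (f : VVDS E) (n : ℕ) :
    ∃ δ : ℝ, ∀ j, j ≠ n → Complex.exp ((δ * (f.lam j - f.lam n) : ℝ) * Complex.I) ≠ 1 := by
  have hc : (⋃ j : ℕ, ⋃ k : ℤ, {2 * Real.pi * k / (f.lam j - f.lam n)} : Set ℝ).Countable :=
    Set.countable_iUnion fun j => Set.countable_iUnion fun k => Set.countable_singleton _
  obtain ⟨δ, hδ⟩ := (Set.nonempty_compl.2 (fun h => Set.not_countable_univ (α := ℝ) (h ▸ hc)))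
  refine ⟨δ, fun j hj h => hδ ?_⟩
  rw [Complex.exp_eq_one_iff] at h
  obtain ⟨k, hk⟩ := h
  have hne : f.lam j - f.lam n ≠ 0 := sub_ne_zero.2 (fun h => hj (f.lam_strictMono.injective h))
  simp only [Set.mem_iUnion, Set.mem_singleton_iff]
  refine ⟨j, k, ?_⟩
  rw [eq_div_iff hne]
  have h3 : ((δ * (f.lam j - f.lam n) : ℝ) : ℂ) = ((2 * Real.pi * k : ℝ) : ℂ) := by
    apply mul_right_cancel₀ Complex.I_ne_zero
    rw [hk]; push_cast; ring
  exact_mod_cast h3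

lemma VVDS.coeff_le (f : VVDS E) (n : ℕ) (σ : ℝ) :
    Real.exp (σ * f.lam n) * ‖f.a n‖ ≤ f.M σ := by
  obtain ⟨δ, hδ⟩ := f.exists_delta n
  set z : ℕ → ℂ := fun j => Complex.exp ((δ * (f.lam j - f.lam n) : ℝ) * Complex.I) with hz
  have hz1 : ∀ j, ‖z j‖ = 1 := fun j => Complex.norm_exp_ofReal_mul_I _
  have hzn : z n = 1 := by simp [hz]
  set c : ℕ → ℕ → ℂ := fun N j => (N : ℂ)⁻¹ * ∑ k ∈ Finset.range N, z j ^ k with hcdef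
  set w : ℕ → ℂ := fun k => Complex.exp ((-(k * δ * f.lam n) : ℝ) * Complex.I) with hw
  have hw1 : ∀ k, ‖w k‖ = 1 := fun j => Complex.norm_exp_ofReal_mul_I _
  set b : ℕ → E := fun j => ((Real.exp (σ * f.lam j) : ℝ) : ℂ) • f.a j with hb
  have hbn : ∀ j, ‖b j‖ = Real.exp (σ * f.lam j) * ‖f.a j‖ := fun j => by
    rw [hb]; simp only [norm_smul, Complex.norm_real, Real.norm_eq_abs, Real.abs_exp]
  have hbs : Summable b := Summable.of_norm (by simpa only [hbn] using f.summable_real σ)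
  have hc1 : ∀ N j, ‖c N j‖ ≤ 1 := by
    intro N j
    rw [hcdef]
    simp only [norm_mul, norm_inv, Complex.norm_natCast]
    have : ‖∑ k ∈ Finset.range N, z j ^ k‖ ≤ N := by
      refine (norm_sum_le _ _).trans ?_
      simp [hz1]
    calc (N : ℝ)⁻¹ * ‖∑ k ∈ Finset.range N, z j ^ k‖ ≤ (N : ℝ)⁻¹ * N := by gcongr
      _ ≤ 1 := inv_mul_le_one
  have key : ∀ N, ∑' j, c N j • b j = (N : ℂ)⁻¹ • ∑ k ∈ Finset.range N,
      w k • f.toFun ((σ : ℂ) + ((k * δ : ℝ) : ℂ) * Complex.I) := by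
    intro N
    have e1 : ∀ k : ℕ, w k • f.toFun ((σ : ℂ) + ((k * δ : ℝ) : ℂ) * Complex.I)
        = ∑' j, z j ^ k • b j := by
      intro k
      unfold VVDS.toFun
      rw [← (f.summable_term σ (k * δ)).tsum_const_smul]
      congr 1
      ext j
      simp only [hw, hz, hb, smul_smul]
      congr 1
      push_cast
      rw [← Complex.exp_nat_mul, ← Complex.exp_add, ← Complex.exp_add]
      congr 1
      ring
    have hs : ∀ k : ℕ, Summable fun j => z j ^ k • b j := by
      intro k
      apply Summable.of_norm
      simpa only [norm_smul, norm_pow, hz1, one_pow, one_mul, hbn] using f.summable_real σ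
    simp only [e1]
    rw [← Summable.tsum_finsetSum (fun k _ => hs k),
      ← (summable_sum (fun k _ => hs k)).tsum_const_smul]
    congr 1
    ext j
    rw [hcdef]
    simp only [mul_smul, Finset.sum_smul]
  have hM0 : 0 ≤ f.M σ := (norm_nonneg _).trans (f.norm_le_M σ 0)
  have hle : ∀ N, ‖∑' j, c N j • b j‖ ≤ f.M σ := by
    intro N
    rw [key, norm_smul, norm_inv, Complex.norm_natCast]
    have : ‖∑ k ∈ Finset.range N, w k • f.toFun ((σ : ℂ) + ((k * δ : ℝ) : ℂ) * Complex.I)‖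
        ≤ N * f.M σ := by
      refine (norm_sum_le_of_le _ (f := _) (n := fun _ => f.M σ) (fun k _ => ?_)).trans (by simp)
      rw [norm_smul, hw1, one_mul]
      exact f.norm_le_M σ _
    calc (N : ℝ)⁻¹ * _ ≤ (N : ℝ)⁻¹ * (N * f.M σ) := by gcongr
      _ = ((N : ℝ)⁻¹ * N) * f.M σ := by ring
      _ ≤ 1 * f.M σ := by gcongr; exact inv_mul_le_one
      _ = f.M σ := one_mul _
  have hT : Tendsto (fun N => ∑' j, c N j • b j) atTop (𝓝 (∑' j, if j = n then b n else 0)) := by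
    refine tendsto_tsum_of_dominated_convergence (bound := fun j => ‖b j‖)
      (by simpa only [hbn] using f.summable_real σ) (fun j => ?_) ?_
    · by_cases hj : j = n
      · subst hj
        rw [if_pos rfl]
        refine tendsto_const_nhds.congr' ?_
        filter_upwards [eventually_gt_atTop 0] with N hN
        have : (N : ℂ) ≠ 0 := by exact_mod_cast hN.ne'
        simp [hcdef, hzn, this]
      · rw [if_neg hj]
        have := (mean_geom_tendsto (z j) (hz1 j) (hδ j hj)).smul_const (b j)
        simpa using this
    · refine Eventually.of_forall fun N j => ?_
      rw [norm_smul]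
      exact mul_le_of_le_one_left (norm_nonneg _) (hc1 N j)
  rw [tsum_ite_eq] at hT
  rw [← hbn]
  exact le_of_tendsto hT.norm (Eventually.of_forall hle)

lemma VVDS.M_tendsto (f : VVDS E) : Tendsto f.M atTop atTop := by
  obtain ⟨n, hn⟩ := (f.coeff_decay.eventually (eventually_lt_atBot 0)).exists
  have ha : 0 < ‖f.a n‖ := by
    rcases (norm_nonneg (f.a n)).eq_or_lt with h | h
    · rw [← h] at hn; simp at hn
    · exact h
  refine tendsto_atTop_mono (f.coeff_le n) ?_
  exact (Real.tendsto_exp_atTop.comp (tendsto_id.atTop_mul_const (f.lam_pos n))).atTop_mul_const ha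

lemma VVDS.Minv_spec (g : VVDS E) (R y : ℝ) (hy : g.S R < y) :
    R ≤ g.Minv y ∧ g.M (g.Minv y) = y := by
  have hlb : ∀ x ∈ {σ : ℝ | y ≤ g.M σ}, R ≤ x := by
    intro x hx
    by_contra hlt
    have h1 := g.S_mono (le_of_not_ge hlt)
    have h2 := g.M_le_S x
    have h3 : y ≤ g.M x := hx
    linarith
  have hne : {σ : ℝ | y ≤ g.M σ}.Nonempty := (g.M_tendsto.eventually (eventually_ge_atTop y)).exists
  have hbdd : BddBelow {σ : ℝ | y ≤ g.M σ} := ⟨R, hlb⟩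
  have hcl : IsClosed {σ : ℝ | y ≤ g.M σ} := isClosed_le continuous_const g.M_continuous
  have hmem : y ≤ g.M (g.Minv y) := hcl.csInf_mem hne hbdd
  refine ⟨le_csInf hne hlb, le_antisymm ?_ hmem⟩
  have hev : ∀ x ∈ Set.Iio (g.Minv y), g.M x ≤ y := by
    intro x hx
    by_contra hlt
    exact absurd (csInf_le hbdd (show x ∈ {σ : ℝ | y ≤ g.M σ} from le_of_not_ge hlt)) (not_le.2 hx)
  refine le_of_tendsto (f := g.M) (x := 𝓝[<] (g.Minv y)) ?_ (eventually_nhdsWithin_of_forall hev)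
  exact g.M_continuous.continuousAt.tendsto.mono_left nhdsWithin_le_nhds

lemma VVDS.Minv_tendsto (g : VVDS E) : Tendsto g.Minv atTop atTop := by
  rw [tendsto_atTop]
  intro R
  filter_upwards [eventually_gt_atTop (g.S R)] with y hy
  exact (g.Minv_spec R y hy).1

lemma tendsto_of_order {u : ℝ → ℝ}
    (h1 : (0 : EReal) < liminf (fun σ => (u σ : EReal)) atTop)
    (h2 : liminf (fun σ => (u σ : EReal)) atTop = limsup (fun σ => (u σ : EReal)) atTop)
    (h3 : limsup (fun σ => (u σ : EReal)) atTop < ⊤) :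
    0 < (limsup (fun σ => (u σ : EReal)) atTop).toReal ∧
      Tendsto u atTop (𝓝 (limsup (fun σ => (u σ : EReal)) atTop).toReal) := by
  have ht := tendsto_of_liminf_eq_limsup h2 rfl
  rw [h2] at h1
  generalize limsup (fun σ => (u σ : EReal)) atTop = L at *
  lift L to ℝ using ⟨h3.ne, (lt_trans EReal.bot_lt_zero h1).ne'⟩
  rw [EReal.toReal_coe]
  exact ⟨by exact_mod_cast h1, EReal.tendsto_coe.1 ht⟩

theorem stmt_3 (f : VVDS E) (g : VVDS F) (h : VVDS G) (p q m : ℕ)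
    (hf1 : (0 : EReal) < relRittLowerOrder m q f h)
    (hfr : relRittLowerOrder m q f h = relRittOrder m q f h)
    (hf3 : relRittOrder m q f h < ⊤)
    (hg1 : (0 : EReal) < relRittLowerOrder m p g h)
    (hgr : relRittLowerOrder m p g h = relRittOrder m p g h)
    (hg3 : relRittOrder m p g h < ⊤)
    :
    relRittLowerOrder p q f g = relRittOrder p q f g ∧ relRittOrder p q f g = (((relRittOrder m q f h).toReal / (relRittOrder m p g h).toReal : ℝ) : EReal) := by
  obtain ⟨hA, hu⟩ := tendsto_of_order hf1 hfr hf3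
  obtain ⟨hB, hv⟩ := tendsto_of_order hg1 hgr hg3
  change 0 < (relRittOrder m q f h).toReal at hA
  change 0 < (relRittOrder m p g h).toReal at hB
  change Tendsto _ _ (𝓝 (relRittOrder m q f h).toReal) at hu
  change Tendsto _ _ (𝓝 (relRittOrder m p g h).toReal) at hv
  have hw := hu.div (hv.comp (g.Minv_tendsto.comp f.M_tendsto)) hB.ne'
  have hlim : Tendsto (fun σ : ℝ => Real.log^[p] (g.Minv (f.M σ)) / Real.log^[q] σ) atTop
      (𝓝 ((relRittOrder m q f h).toReal / (relRittOrder m p g h).toReal)) := by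
    refine hw.congr' ?_
    filter_upwards [hu.eventually (eventually_gt_nhds hA),
      f.M_tendsto.eventually (eventually_gt_atTop (g.S 0))] with σ h1 h2
    have h3 := (g.Minv_spec 0 _ h2).2
    simp only [Pi.div_apply, Function.comp_apply, h3]
    have h4 : Real.log^[m] (h.Minv (f.M σ)) ≠ 0 := by
      intro h0
      rw [h0, zero_div] at h1
      exact lt_irrefl _ h1
    exact div_div_div_cancel_left' _ _ h4
  have hE := EReal.tendsto_coe.2 hlim
  have e1 : relRittOrder p q f g = _ := hE.limsup_eq
  have e2 : relRittLowerOrder p q f g = _ := hE.liminf_eq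
  exact ⟨e2.trans e1.symm, e1⟩
end
end

section
/- Let f, g and h be entire functions given by everywhere absolutely convergent vector valued Dirichlet series, and let p ≥ 0, q ≥ 0, m ≥ 0 be integers. Assume 0 < λ_h^{(m,q)}(f) ≤ ρ_h^{(m,q)}(f) < +∞, 0 < λ_h^{(m,p)}(g) ≤ ρ_h^{(m,p)}(g) < +∞, and that the indicators Δ_h^{(m,q)}(f), Δ̄_h^{(m,q)}(f), Δ_h^{(m,p)}(g), Δ̄_h^{(m,p)}(g), τ̄_h^{(m,p)}(g) are all positive and finite. Then (Δ̄_h^{(m,q)}(f)/τ̄_h^{(m,p)}(g))^{1/λ_h^{(m,p)}(g)} ≤ Δ̄_g^{(p,q)}(f) ≤ min{ (Δ̄_h^{(m,q)}(f)/Δ̄_h^{(m,p)}(g))^{1/ρ_h^{(m,p)}(g)}, (Δ_h^{(m,q)}(f)/Δ_h^{(m,p)}(g))^{1/ρ_h^{(m,p)}(g)} }. -/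
open Filter Topology

noncomputable section

variable {E F G : Type*} [NormedAddCommGroup E] [NormedSpace ℂ E] [CompleteSpace E]
  [NormedAddCommGroup F] [NormedSpace ℂ F] [CompleteSpace F]
  [NormedAddCommGroup G] [NormedSpace ℂ G] [CompleteSpace G]

namespace VVDS

/-- majorant -/
def S_s14 (f : VVDS E) (σ : ℝ) : ℝ := ∑' n, Real.exp (σ * f.lam n) * ‖f.a n‖

lemma summ (f : VVDS E) (σ : ℝ) : Summable (fun n => Real.exp (σ * f.lam n) * ‖f.a n‖) := by
  simpa using f.abs_conv (σ : ℂ)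

lemma norm_term_s14 (f : VVDS E) (s : ℂ) (n : ℕ) :
    ‖Complex.exp (s * (f.lam n : ℂ)) • f.a n‖ = Real.exp (s.re * f.lam n) * ‖f.a n‖ := by
  rw [norm_smul, Complex.norm_exp]; simp

lemma summ_term (f : VVDS E) (s : ℂ) :
    Summable (fun n => Complex.exp (s * (f.lam n : ℂ)) • f.a n) := by
  apply Summable.of_norm
  simp_rw [norm_term_s14]
  exact f.summ s.re

lemma norm_toFun_le (f : VVDS E) (s : ℂ) : ‖f.toFun s‖ ≤ f.S_s14 s.re := by
  unfold toFun S_s14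
  refine (norm_tsum_le_tsum_norm ?_).trans ?_
  · simp_rw [norm_term_s14]; exact f.summ s.re
  · simp_rw [norm_term_s14]; exact le_rfl

lemma bdd_s14 (f : VVDS E) (σ : ℝ) :
    BddAbove (Set.range fun t : ℝ => ‖f.toFun ((σ : ℂ) + (t : ℂ) * Complex.I)‖) := by
  refine ⟨f.S_s14 σ, ?_⟩
  rintro _ ⟨t, rfl⟩
  simpa using f.norm_toFun_le ((σ : ℂ) + (t : ℂ) * Complex.I)

lemma M_le_S_s14 (f : VVDS E) (σ : ℝ) : f.M σ ≤ f.S_s14 σ := by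
  refine ciSup_le fun t => ?_
  simpa using f.norm_toFun_le ((σ : ℂ) + (t : ℂ) * Complex.I)

lemma le_M (f : VVDS E) (σ t : ℝ) : ‖f.toFun ((σ : ℂ) + (t : ℂ) * Complex.I)‖ ≤ f.M σ :=
  le_ciSup (f.bdd_s14 σ) t

lemma S_mono_s14 (f : VVDS E) : Monotone f.S_s14 := by
  intro a b hab
  refine Summable.tsum_le_tsum (fun n => ?_) (f.summ a) (f.summ b)
  have := f.lam_pos n
  gcongr

/-- modulus of continuity -/
lemma M_sub_le (f : VVDS E) (σ σ' : ℝ) :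
    f.M σ ≤ f.M σ' + ∑' n, |Real.exp (σ * f.lam n) - Real.exp (σ' * f.lam n)| * ‖f.a n‖ := by
  refine ciSup_le fun t => ?_
  have hs : Summable fun n => |Real.exp (σ * f.lam n) - Real.exp (σ' * f.lam n)| * ‖f.a n‖ := by
    refine Summable.of_nonneg_of_le (fun n => by positivity) (fun n => ?_)
      ((f.summ σ).add (f.summ σ'))
    rw [← add_mul]
    gcongr
    refine (abs_sub _ _).trans ?_
    simp [abs_of_pos (Real.exp_pos _)]
  have h1 : ‖f.toFun ((σ : ℂ) + (t : ℂ) * Complex.I) - f.toFun ((σ' : ℂ) + (t : ℂ) * Complex.I)‖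
      ≤ ∑' n, |Real.exp (σ * f.lam n) - Real.exp (σ' * f.lam n)| * ‖f.a n‖ := by
    unfold toFun
    rw [← Summable.tsum_sub (f.summ_term _) (f.summ_term _)]
    have key : ∀ n, ‖Complex.exp (((σ : ℂ) + (t : ℂ) * Complex.I) * (f.lam n : ℂ)) • f.a n
        - Complex.exp (((σ' : ℂ) + (t : ℂ) * Complex.I) * (f.lam n : ℂ)) • f.a n‖
        = |Real.exp (σ * f.lam n) - Real.exp (σ' * f.lam n)| * ‖f.a n‖ := by
      intro n
      rw [← sub_smul, norm_smul]
      congr 1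
      have : Complex.exp (((σ : ℂ) + (t : ℂ) * Complex.I) * (f.lam n : ℂ))
        - Complex.exp (((σ' : ℂ) + (t : ℂ) * Complex.I) * (f.lam n : ℂ))
        = ((Real.exp (σ * f.lam n) - Real.exp (σ' * f.lam n) : ℝ) : ℂ)
          * Complex.exp (((t * f.lam n : ℝ) : ℂ) * Complex.I) := by
        push_cast
        rw [sub_mul, ← Complex.exp_add, ← Complex.exp_add]
        congr 2 <;> ring
      rw [this, norm_mul, Complex.norm_exp_ofReal_mul_I, mul_one, Complex.norm_real,
        Real.norm_eq_abs]
    refine (norm_tsum_le_tsum_norm ?_).trans ?_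
    · simp_rw [key]; exact hs
    · simp_rw [key]; exact le_rfl
  have h2 := f.le_M σ' t
  have h3 := norm_sub_norm_le (f.toFun ((σ : ℂ) + (t : ℂ) * Complex.I))
    (f.toFun ((σ' : ℂ) + (t : ℂ) * Complex.I))
  linarith

lemma M_continuous_s14 (f : VVDS E) : Continuous f.M := by
  rw [continuous_iff_continuousAt]
  intro σ
  have hd : Tendsto (fun σ' => ∑' n, |Real.exp (σ * f.lam n) - Real.exp (σ' * f.lam n)| * ‖f.a n‖)
      (𝓝 σ) (𝓝 (∑' _ : ℕ, (0:ℝ))) := by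
    refine tendsto_tsum_of_dominated_convergence
      (bound := fun n => 2 * (Real.exp ((σ + 1) * f.lam n) * ‖f.a n‖))
      ((f.summ (σ+1)).mul_left 2) (fun n => ?_) ?_
    · have : Continuous fun σ' : ℝ => |Real.exp (σ * f.lam n) - Real.exp (σ' * f.lam n)| * ‖f.a n‖ := by
        fun_prop
      have h := this.tendsto σ
      simpa using h
    · filter_upwards [Iio_mem_nhds (show σ < σ + 1 by linarith)] with σ' h' n
      have hl := f.lam_pos n
      rw [Real.norm_eq_abs, abs_of_nonneg (by positivity), ← mul_assoc]
      gcongr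
      refine (abs_sub _ _).trans ?_
      simp only [Real.abs_exp]
      have h1 : Real.exp (σ * f.lam n) ≤ Real.exp ((σ+1) * f.lam n) := by gcongr; linarith
      have h2 : Real.exp (σ' * f.lam n) ≤ Real.exp ((σ+1) * f.lam n) := by gcongr; exact h'.le
      linarith
  rw [tsum_zero] at hd
  rw [ContinuousAt, tendsto_iff_norm_sub_tendsto_zero]
  refine squeeze_zero (fun _ => norm_nonneg _) (fun σ' => ?_) hd
  have h1 := f.M_sub_le σ σ'
  have h2 := f.M_sub_le σ' σ
  simp_rw [abs_sub_comm (Real.exp (σ' * _))] at h2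
  rw [Real.norm_eq_abs, abs_le]
  constructor <;> linarith

/-- averages of unimodular powers -/
lemma avg_tendsto (z : ℂ) (hz : ‖z‖ = 1) (h1 : z ≠ 1) :
    Tendsto (fun N : ℕ => (∑ k ∈ Finset.range N, z ^ k) / (N : ℂ)) atTop (𝓝 0) := by
  have hb : ∀ N : ℕ, ‖(∑ k ∈ Finset.range N, z ^ k) / (N : ℂ)‖ ≤ (2 / ‖z - 1‖) / N := by
    intro N
    rw [geom_sum_eq h1, norm_div, norm_div, Complex.norm_natCast]
    gcongr
    refine (norm_sub_le _ _).trans ?_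
    simp [hz]; norm_num
  exact squeeze_zero_norm hb (tendsto_const_div_atTop_nhds_zero_nat _)

lemma exists_step (f : VVDS E) (n : ℕ) : ∃ δ : ℝ, ∀ j, j ≠ n →
    Complex.exp (((f.lam j - f.lam n) * δ : ℝ) * Complex.I) ≠ 1 := by
  have hc : (⋃ (j : ℕ), ⋃ (k : ℤ), {(k * (2 * Real.pi)) / (f.lam j - f.lam n)} : Set ℝ).Countable :=
    Set.countable_iUnion fun j => Set.countable_iUnion fun k => Set.countable_singleton _
  obtain ⟨δ, hδ⟩ : ∃ δ : ℝ, δ ∉ (⋃ (j : ℕ), ⋃ (k : ℤ),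
      {(k * (2 * Real.pi)) / (f.lam j - f.lam n)} : Set ℝ) := by
    by_contra! hcon
    exact Set.not_countable_univ (hc.mono fun x _ => hcon x)
  refine ⟨δ, fun j hj h => hδ ?_⟩
  rw [Complex.exp_eq_one_iff] at h
  obtain ⟨k, hk⟩ := h
  simp only [Set.mem_iUnion, Set.mem_singleton_iff]
  refine ⟨j, k, ?_⟩
  have hne : f.lam j - f.lam n ≠ 0 := sub_ne_zero.2 fun e => hj (f.lam_strictMono.injective e)
  rw [eq_div_iff hne]
  have : (((f.lam j - f.lam n) * δ : ℝ) : ℂ) = ((k * (2 * Real.pi) : ℝ) : ℂ) := by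
    apply mul_right_cancel₀ Complex.I_ne_zero
    rw [hk]; push_cast; ring
  have := Complex.ofReal_injective this
  linarith

lemma coeff_le_M (f : VVDS E) (σ : ℝ) (n : ℕ) : Real.exp (σ * f.lam n) * ‖f.a n‖ ≤ f.M σ := by
  obtain ⟨δ, hδ⟩ := f.exists_step n
  set z : ℕ → ℂ := fun j => Complex.exp (((f.lam j - f.lam n) * δ : ℝ) * Complex.I) with hz
  have hznorm : ∀ j, ‖z j‖ = 1 := fun j => Complex.norm_exp_ofReal_mul_I _
  have hzn : z n = 1 := by simp [hz]
  let c : ℕ → E := fun j => Complex.exp ((σ : ℂ) * (f.lam j : ℂ)) • f.a j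
  have hcn : ∀ j, ‖c j‖ = Real.exp (σ * f.lam j) * ‖f.a j‖ := fun j => by
    simpa using f.norm_term_s14 (σ : ℂ) j
  -- averages
  let u : ℕ → E := fun N => ∑' j, ((∑ k ∈ Finset.range N, z j ^ k) / (N : ℂ)) • c j
  have hzavg : ∀ N j, ‖(∑ k ∈ Finset.range N, z j ^ k) / (N : ℂ)‖ ≤ 1 := by
    intro N j
    rw [norm_div, Complex.norm_natCast]
    refine div_le_one_of_le₀ ?_ (by positivity)
    refine (norm_sum_le _ _).trans ?_
    simp [hznorm]
  have hu : Tendsto u atTop (𝓝 (∑' j, if j = n then c n else 0)) := by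
    refine tendsto_tsum_of_dominated_convergence (f.summ σ) (fun j => ?_) ?_
    · split_ifs with hj
      · subst hj
        refine tendsto_const_nhds.congr' ?_
        filter_upwards [eventually_gt_atTop 0] with N hN
        have : (N : ℂ) ≠ 0 := by exact_mod_cast hN.ne'
        simp [hzn, this]
      · simpa using (avg_tendsto (z j) (hznorm j) (hδ j hj)).smul_const (c j)
    · refine Eventually.of_forall fun N j => ?_
      rw [norm_smul, hcn]
      exact mul_le_of_le_one_left (by positivity) (hzavg N j)
  rw [tsum_ite_eq] at hu
  have hub : ∀ᶠ N in atTop, ‖u N‖ ≤ f.M σ := by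
    filter_upwards [eventually_gt_atTop 0] with N hN
    have hN' : (N : ℂ) ≠ 0 := by exact_mod_cast hN.ne'
    have hsk : ∀ k, Summable fun j => (z j ^ k) • c j := by
      intro k
      apply Summable.of_norm
      simp_rw [norm_smul, norm_pow, hznorm, one_pow, one_mul, hcn]
      exact f.summ σ
    have e1 : u N = (N : ℂ)⁻¹ • ∑ k ∈ Finset.range N, ∑' j, (z j ^ k) • c j := by
      rw [← Summable.tsum_finsetSum (fun k _ => hsk k), ← Summable.tsum_const_smul]
      · refine tsum_congr fun j => ?_
        rw [← Finset.sum_smul, div_eq_inv_mul, mul_smul]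
      · exact summable_sum fun k _ => hsk k
    have e2 : ∀ k, ‖∑' j, (z j ^ k) • c j‖ ≤ f.M σ := by
      intro k
      have e3 : ∑' j, (z j ^ k) • c j = Complex.exp (((-(f.lam n * δ * k) : ℝ) : ℂ) * Complex.I) •
          f.toFun ((σ : ℂ) + ((δ * k : ℝ) : ℂ) * Complex.I) := by
        unfold toFun
        rw [← Summable.tsum_const_smul _ (f.summ_term _)]
        refine tsum_congr fun j => ?_
        simp only [hz, c]
        rw [smul_smul, smul_smul, ← Complex.exp_nat_mul, ← Complex.exp_add, ← Complex.exp_add]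
        congr 2
        push_cast; ring
      rw [e3, norm_smul, Complex.norm_exp_ofReal_mul_I, one_mul]
      exact f.le_M σ _
    rw [e1, norm_smul, norm_inv, Complex.norm_natCast]
    have hNr : (0:ℝ) < N := by exact_mod_cast hN
    rw [inv_mul_le_iff₀ hNr]
    refine (norm_sum_le _ _).trans ((Finset.sum_le_sum fun k _ => e2 k).trans ?_)
    simp
  have := le_of_tendsto hu.norm hub
  rwa [hcn] at this

lemma M_tendsto_s14 (f : VVDS E) : Tendsto f.M atTop atTop := by
  obtain ⟨n, hn⟩ : ∃ n, f.a n ≠ 0 := by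
    obtain ⟨n, hn⟩ := (f.coeff_decay.eventually (eventually_lt_atBot 0)).exists
    refine ⟨n, fun h => ?_⟩
    simp [h] at hn
  refine tendsto_atTop_mono (fun σ => f.coeff_le_M σ n) ?_
  exact (Real.tendsto_exp_atTop.comp (tendsto_id.atTop_mul_const (f.lam_pos n))).atTop_mul_const
    (norm_pos_iff.2 hn)

lemma set_bdd (f : VVDS E) {c y : ℝ} (hy : f.S_s14 c < y) : ∀ σ ∈ {σ : ℝ | y ≤ f.M σ}, c ≤ σ := by
  intro σ hσ
  by_contra! h
  have : f.M σ ≤ f.S_s14 c := (f.M_le_S_s14 σ).trans (f.S_mono_s14 h.le)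
  have h2 : y ≤ f.M σ := hσ
  linarith

lemma set_nonempty (f : VVDS E) (y : ℝ) : {σ : ℝ | y ≤ f.M σ}.Nonempty :=
  (f.M_tendsto_s14.eventually (eventually_ge_atTop y)).exists

lemma Minv_tendsto_s14 (f : VVDS E) : Tendsto f.Minv atTop atTop := by
  rw [tendsto_atTop]
  intro c
  filter_upwards [eventually_gt_atTop (f.S_s14 c)] with y hy
  exact le_csInf (f.set_nonempty y) (f.set_bdd hy)

lemma M_Minv (f : VVDS E) : ∀ᶠ y in atTop, f.M (f.Minv y) = y := by
  filter_upwards [eventually_gt_atTop (f.S_s14 0)] with y hy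
  have hcl : IsClosed {σ : ℝ | y ≤ f.M σ} := isClosed_le continuous_const f.M_continuous_s14
  have hb : BddBelow {σ : ℝ | y ≤ f.M σ} := ⟨0, fun σ h => f.set_bdd hy σ h⟩
  have hmem := hcl.csInf_mem (f.set_nonempty y) hb
  apply le_antisymm _ hmem
  refine le_of_tendsto (f.M_continuous_s14.continuousAt.tendsto.mono_left
    (nhdsWithin_le_nhds (s := Set.Iio (f.Minv y)))) ?_
  filter_upwards [self_mem_nhdsWithin] with σ hσ
  by_contra! hcon
  exact absurd (csInf_le hb (show σ ∈ {σ : ℝ | y ≤ f.M σ} from hcon.le)) (not_le.2 hσ)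

lemma Minv_M_le (f : VVDS E) : ∀ᶠ s in atTop, f.Minv (f.M s) ≤ s := by
  filter_upwards [f.M_tendsto_s14.eventually (eventually_gt_atTop (f.S_s14 0))] with s hs
  exact csInf_le ⟨0, fun σ h => f.set_bdd hs σ h⟩ (le_refl (f.M s))

end VVDS

lemma logit_tendsto (k : ℕ) : Tendsto (Real.log^[k]) atTop atTop := by
  induction k with
  | zero => exact tendsto_id
  | succ k ih => rw [Function.iterate_succ']; exact Real.tendsto_log_atTop.comp ih

lemma logit_mono (k : ℕ) : ∃ K : ℝ, ∀ a b, K ≤ a → a ≤ b → Real.log^[k] a ≤ Real.log^[k] b := by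
  induction k with
  | zero => exact ⟨0, fun a b _ h => h⟩
  | succ k ih =>
    obtain ⟨K, hK⟩ := ih
    obtain ⟨K', hK'⟩ := eventually_atTop.1 ((logit_tendsto k).eventually (eventually_gt_atTop 0))
    refine ⟨max K K', fun a b ha hab => ?_⟩
    rw [Function.iterate_succ_apply', Function.iterate_succ_apply']
    exact Real.log_le_log (hK' a (le_of_max_le_right ha)) (hK a b (le_of_max_le_left ha) hab)

/-- m = 0, q ≥ 1 is impossible -/
lemma contra1 {A X : ℝ → ℝ} (hA : Tendsto A atTop atTop) (hX : Tendsto X atTop atTop) {α : ℝ}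
    (hα : 0 < α) (h1 : limsup (fun σ => ((A σ / Real.log (X σ) : ℝ) : EReal)) atTop = α)
    (h2 : 0 < limsup (fun σ => ((A σ / X σ ^ α : ℝ) : EReal)) atTop) : False := by
  have h3 : ∀ᶠ σ in atTop, ((A σ / Real.log (X σ) : ℝ) : EReal) < ((α + 1 : ℝ) : EReal) := by
    refine eventually_lt_of_limsup_lt ?_
    rw [h1]; exact_mod_cast lt_add_one α
  have h4 : Tendsto (fun σ => A σ / X σ ^ α) atTop (𝓝 0) := by
    have h5 : Tendsto (fun σ => (α + 1) * (Real.log (X σ) / X σ ^ α)) atTop (𝓝 0) := by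
      have := ((isLittleO_log_rpow_atTop hα).tendsto_div_nhds_zero.comp hX).const_mul (α + 1)
      simpa using this
    refine squeeze_zero' ?_ ?_ h5
    · filter_upwards [hA.eventually (eventually_gt_atTop 0), hX.eventually (eventually_gt_atTop 0)]
        with σ ha hx
      positivity
    · filter_upwards [h3, hX.eventually (eventually_gt_atTop 1)] with σ ha hx
      have ha := EReal.coe_lt_coe_iff.1 ha
      have hl := Real.log_pos hx
      rw [div_lt_iff₀ hl] at ha
      rw [← mul_div_assoc]
      gcongr
  have h6 : Tendsto (fun σ => ((A σ / X σ ^ α : ℝ) : EReal)) atTop (𝓝 ((0:ℝ) : EReal)) :=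
    (continuous_coe_real_ereal.tendsto 0).comp h4
  rw [h6.limsup_eq] at h2
  simp at h2

/-- m ≥ 1, q = 0 is impossible -/
lemma contra2 {A : ℝ → ℝ} (hA : Tendsto A atTop atTop) {α : ℝ}
    (h1 : 0 < liminf (fun σ : ℝ => ((Real.log (A σ) / σ : ℝ) : EReal)) atTop)
    (h2 : limsup (fun σ : ℝ => ((A σ / σ ^ α : ℝ) : EReal)) atTop < ⊤) : False := by
  obtain ⟨c, hc0, hc⟩ := EReal.lt_iff_exists_real_btwn.1 h1
  have hc0 : 0 < c := by exact_mod_cast hc0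
  have h3 := eventually_lt_of_lt_liminf hc
  obtain ⟨C, hC, _⟩ := EReal.lt_iff_exists_real_btwn.1 h2
  have h4 := eventually_lt_of_limsup_lt hC
  have h5 : Tendsto (fun σ : ℝ => Real.exp (c * σ) / σ ^ α) atTop atTop :=
    tendsto_exp_mul_div_rpow_atTop α c hc0
  obtain ⟨σ, ha, hb, hσ, hd, hA⟩ := (h3.and (h4.and ((eventually_gt_atTop 0).and
    ((h5.eventually (eventually_gt_atTop C)).and (hA.eventually (eventually_gt_atTop 0)))))).exists
  have ha := EReal.coe_lt_coe_iff.1 ha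
  have hb := EReal.coe_lt_coe_iff.1 hb
  rw [lt_div_iff₀ hσ, Real.lt_log_iff_exp_lt hA] at ha
  have : Real.exp (c * σ) / σ ^ α ≤ A σ / σ ^ α := by
    have := Real.rpow_pos_of_pos hσ α
    gcongr
  linarith

/-- regular growth -/
lemma regular {A X : ℝ → ℝ} (hA : Tendsto A atTop atTop) (hX : Tendsto X atTop atTop) {α : ℝ}
    (h1 : limsup (fun σ => ((Real.log (A σ) / Real.log (X σ) : ℝ) : EReal)) atTop = α)
    (h2 : 0 < liminf (fun σ => ((A σ / X σ ^ α : ℝ) : EReal)) atTop) :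
    Tendsto (fun σ => Real.log (A σ) / Real.log (X σ)) atTop (𝓝 α) := by
  obtain ⟨c, hc0, hc⟩ := EReal.lt_iff_exists_real_btwn.1 h2
  have hc0 : 0 < c := by exact_mod_cast hc0
  have h3 := eventually_lt_of_lt_liminf hc
  have h4 : Tendsto (fun σ => α + Real.log c / Real.log (X σ)) atTop (𝓝 α) := by
    have := ((Real.tendsto_log_atTop.comp hX).const_div_atTop (Real.log c)).const_add α
    simpa using this
  have h5 : ∀ᶠ σ in atTop, α + Real.log c / Real.log (X σ) ≤ Real.log (A σ) / Real.log (X σ) := by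
    filter_upwards [h3, hX.eventually (eventually_gt_atTop 1)] with σ ha hx
    have ha := EReal.coe_lt_coe_iff.1 ha
    have hl := Real.log_pos hx
    have hx0 : 0 < X σ := by linarith
    have hp := Real.rpow_pos_of_pos hx0 α
    rw [lt_div_iff₀ hp] at ha
    have := Real.log_le_log (by positivity) ha.le
    rw [Real.log_mul hc0.ne' hp.ne', Real.log_rpow hx0] at this
    rw [le_div_iff₀ hl, add_mul, div_mul_cancel₀ _ hl.ne']
    linarith
  have h6 : Tendsto (fun σ => ((α + Real.log c / Real.log (X σ) : ℝ) : EReal)) atTop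
      (𝓝 ((α:ℝ) : EReal)) := (continuous_coe_real_ereal.tendsto α).comp h4
  have h7 : (α : EReal) ≤ liminf (fun σ => ((Real.log (A σ) / Real.log (X σ) : ℝ) : EReal)) atTop := by
    rw [← h6.liminf_eq]
    refine liminf_le_liminf ?_
    filter_upwards [h5] with σ h
    exact_mod_cast h
  have h8 := tendsto_of_le_liminf_of_limsup_le h7 h1.le
  exact EReal.tendsto_coe.1 h8

lemma core {A B X Y s r : ℝ → ℝ} {α β γ D Db D' Db' : ℝ} (hβ : 0 < β) (hγ : γ * β = α)
    (hX : Tendsto X atTop atTop) (hY : Tendsto Y atTop atTop)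
    (hYm : ∃ K : ℝ, ∀ a b, K ≤ a → a ≤ b → Y a ≤ Y b)
    (hs : Tendsto s atTop atTop) (hr : Tendsto r atTop atTop)
    (hAB : ∀ᶠ σ in atTop, A σ = B (s σ))
    (hrs : ∀ᶠ t in atTop, s (r t) ≤ t) (hrA : ∀ᶠ t in atTop, A (r t) = B t)
    (hD0 : 0 < D) (hDb0 : 0 < Db) (hD'0 : 0 < D') (hDb'0 : 0 < Db')
    (hD : limsup (fun σ => ((A σ / X σ ^ α : ℝ) : EReal)) atTop = D)
    (hDb : liminf (fun σ => ((A σ / X σ ^ α : ℝ) : EReal)) atTop = Db)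
    (hD' : limsup (fun σ => ((B σ / Y σ ^ β : ℝ) : EReal)) atTop = D')
    (hDb' : liminf (fun σ => ((B σ / Y σ ^ β : ℝ) : EReal)) atTop = Db') :
    (((Db / D') ^ (1 / β) : ℝ) : EReal) ≤
        liminf (fun σ => ((Y (s σ) / X σ ^ γ : ℝ) : EReal)) atTop ∧
      liminf (fun σ => ((Y (s σ) / X σ ^ γ : ℝ) : EReal)) atTop ≤
        ((min ((Db / Db') ^ (1 / β)) ((D / D') ^ (1 / β)) : ℝ) : EReal) := by
  have hXp := hX.eventually (eventually_gt_atTop 0)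
  have hYp := hY.eventually (eventually_gt_atTop 0)
  have hpow : ∀ x : ℝ, 0 < x → (x ^ γ) ^ β = x ^ α := fun x hx => by
    rw [← Real.rpow_mul hx.le, hγ]
  -- a consequence of a strict lower bound on the liminf
  have cons : ∀ c : ℝ, 0 < c →
      (c : EReal) < liminf (fun σ => ((Y (s σ) / X σ ^ γ : ℝ) : EReal)) atTop →
      ∀ᶠ σ in atTop, c ^ β * X σ ^ α < Y (s σ) ^ β := by
    intro c hc h
    filter_upwards [eventually_lt_of_lt_liminf h, hXp] with σ h1 hx
    have h1 := EReal.coe_lt_coe_iff.1 h1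
    have hp := Real.rpow_pos_of_pos hx γ
    rw [lt_div_iff₀ hp] at h1
    have := Real.rpow_lt_rpow (by positivity) h1 hβ
    rwa [Real.mul_rpow hc.le hp.le, hpow _ hx] at this
  refine ⟨?_, ?_⟩
  · have hlow : ∀ a b : ℝ, 0 < a → a < Db → D' < b → (((a / b) ^ (1 / β) : ℝ) : EReal) ≤
        liminf (fun σ => ((Y (s σ) / X σ ^ γ : ℝ) : EReal)) atTop := by
      intro a b ha0 ha hb
      have h1 := eventually_lt_of_lt_liminf (hDb.symm ▸ (EReal.coe_lt_coe_iff.2 ha))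
      have h2 := hs.eventually
        (eventually_lt_of_limsup_lt (hD'.symm ▸ (EReal.coe_lt_coe_iff.2 hb)))
      refine le_liminf_of_le (by isBoundedDefault) ?_
      filter_upwards [h1, h2, hXp, hs.eventually hYp, hAB] with σ h1 h2 hx hy hab
      have h1 := EReal.coe_lt_coe_iff.1 h1
      have h2 := EReal.coe_lt_coe_iff.1 h2
      have hb0 : 0 < b := by linarith
      rw [lt_div_iff₀ (Real.rpow_pos_of_pos hx α)] at h1
      rw [div_lt_iff₀ (Real.rpow_pos_of_pos hy β), ← hab] at h2
      have hp := Real.rpow_pos_of_pos hx γ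
      rw [EReal.coe_le_coe_iff, le_div_iff₀ hp]
      rw [← Real.rpow_le_rpow_iff (by positivity) hy.le hβ, Real.mul_rpow (by positivity) hp.le,
        hpow _ hx, ← Real.rpow_mul (by positivity), one_div, inv_mul_cancel₀ hβ.ne', Real.rpow_one,
        div_mul_eq_mul_div, div_le_iff₀ hb0]
      linarith
    have ht : Tendsto (fun e : ℝ => ((((Db - e) / (D' + e)) ^ (1 / β) : ℝ) : EReal)) (𝓝[>] 0)
        (𝓝 (((Db / D') ^ (1 / β) : ℝ) : EReal)) := by
      refine (continuous_coe_real_ereal.tendsto _).comp ?_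
      have : ContinuousAt (fun e : ℝ => ((Db - e) / (D' + e)) ^ (1 / β)) 0 := by
        refine ContinuousAt.rpow_const ?_ (Or.inr (by positivity))
        refine ContinuousAt.div (by fun_prop) (by fun_prop) (by simpa using hD'0.ne')
      have h := this.tendsto
      simp only [sub_zero, add_zero] at h
      exact h.mono_left nhdsWithin_le_nhds
    refine le_of_tendsto ht ?_
    filter_upwards [Ioo_mem_nhdsGT hDb0] with e he
    exact hlow _ _ (by linarith [he.2]) (by linarith [he.1]) (by linarith [he.1])
  · -- upper bounds
    have fin : ∀ U V : ℝ, 0 < U → 0 < V →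
        (∀ c b : ℝ, 0 < c → (c : EReal) <
          liminf (fun σ => ((Y (s σ) / X σ ^ γ : ℝ) : EReal)) atTop → 0 < b → b < V →
            b * c ^ β ≤ U) →
        liminf (fun σ => ((Y (s σ) / X σ ^ γ : ℝ) : EReal)) atTop ≤
          (((U / V) ^ (1 / β) : ℝ) : EReal) := by
      intro U V hU hV H
      by_contra! hcon
      obtain ⟨c, hc1, hc2⟩ := EReal.lt_iff_exists_real_btwn.1 hcon
      have hc1 := EReal.coe_lt_coe_iff.1 hc1
      have hc0 : 0 < c := lt_of_le_of_lt (by positivity) hc1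
      have h1 : V * c ^ β ≤ U := by
        have hcb := Real.rpow_pos_of_pos hc0 β
        rw [← le_div_iff₀ hcb]
        refine le_of_forall_lt_imp_le_of_dense fun b hb => ?_
        rcases le_or_gt b 0 with h0 | h0
        · exact h0.trans (by positivity)
        · rw [le_div_iff₀ hcb]; exact H c b hc0 hc2 h0 hb
      have h2 := Real.rpow_lt_rpow (by positivity) hc1 hβ
      rw [← Real.rpow_mul (by positivity), one_div, inv_mul_cancel₀ hβ.ne', Real.rpow_one,
        div_lt_iff₀ hV] at h2
      linarith
    rw [EReal.coe_strictMono.monotone.map_min]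
    refine le_min (fin _ _ hDb0 hDb'0 ?_) (fin _ _ hD0 hD'0 ?_)
    · intro c b hc0 hc hb0 hb
      rw [← EReal.coe_le_coe_iff, ← hDb]
      refine le_liminf_of_le (by isBoundedDefault) ?_
      have h2 := hs.eventually
        (eventually_lt_of_lt_liminf (hDb'.symm ▸ (EReal.coe_lt_coe_iff.2 hb)))
      filter_upwards [cons c hc0 hc, h2, hXp, hs.eventually hYp, hAB] with σ h1 h2 hx hy hab
      have h2 := EReal.coe_lt_coe_iff.1 h2
      rw [lt_div_iff₀ (Real.rpow_pos_of_pos hy β), ← hab] at h2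
      rw [EReal.coe_le_coe_iff, le_div_iff₀ (Real.rpow_pos_of_pos hx α), mul_assoc]
      exact (mul_le_mul_of_nonneg_left h1.le hb0.le).trans h2.le
    · intro c b hc0 hc hb0 hb
      rw [← EReal.coe_le_coe_iff, ← hD]
      refine le_limsup_of_frequently_le ?_ (by isBoundedDefault)
      have h2 := frequently_lt_of_lt_limsup (by isBoundedDefault)
        (hD'.symm ▸ (EReal.coe_lt_coe_iff.2 hb))
      obtain ⟨K, hK⟩ := hYm
      have hsr := hs.comp hr
      refine hr.frequently ?_
      refine (h2.and_eventually ((hr.eventually (cons c hc0 hc)).and ((hr.eventually hXp).and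
        ((hsr.eventually hYp).and ((hsr.eventually (eventually_ge_atTop K)).and
          (hYp.and (hrs.and hrA))))))).mono ?_
      rintro t ⟨h2, h1, hx, hy, hk, hyt, hst, hat⟩
      have h2 := EReal.coe_lt_coe_iff.1 h2
      rw [lt_div_iff₀ (Real.rpow_pos_of_pos hyt β), ← hat] at h2
      rw [EReal.coe_le_coe_iff, le_div_iff₀ (Real.rpow_pos_of_pos hx α), mul_assoc]
      refine (mul_le_mul_of_nonneg_left h1.le hb0.le).trans (le_trans ?_ h2.le)
      have hmono := hK _ _ hk hst
      simp only [Function.comp] at hy hmono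
      gcongr

/-- multiplication by something tending to one -/
lemma limsup_mul_one {u v : ℝ → ℝ} {c : ℝ} (hu : ∀ᶠ σ in atTop, 0 < u σ)
    (hv : Tendsto v atTop (𝓝 1)) (hc : limsup (fun σ => ((u σ : ℝ) : EReal)) atTop = c) :
    limsup (fun σ => ((u σ * v σ : ℝ) : EReal)) atTop ≤ c := by
  have hc0 : 0 ≤ c := by
    rw [← EReal.coe_le_coe_iff, ← hc]
    exact le_limsup_of_frequently_le (hu.mono fun σ h => EReal.coe_le_coe_iff.2 h.le).frequently
      (by isBoundedDefault)
  have ht : Tendsto (fun e : ℝ => (((c + e) * (1 + e) : ℝ) : EReal)) (𝓝[>] 0) (𝓝 ((c : ℝ) : EReal)) := by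
    refine (continuous_coe_real_ereal.tendsto _).comp ?_
    have : Continuous (fun e : ℝ => (c + e) * (1 + e)) := by fun_prop
    have h := this.tendsto 0
    simp only [add_zero, mul_one] at h
    exact h.mono_left nhdsWithin_le_nhds
  refine ge_of_tendsto ht ?_
  filter_upwards [self_mem_nhdsWithin] with e he
  have he : 0 < e := he
  refine limsup_le_of_le (by isBoundedDefault) ?_
  have h1 : ∀ᶠ σ in atTop, ((u σ : ℝ) : EReal) < ((c + e : ℝ) : EReal) := by
    refine eventually_lt_of_limsup_lt ?_
    rw [hc]; exact EReal.coe_lt_coe_iff.2 (by linarith)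
  filter_upwards [h1, hu, hv.eventually (Iio_mem_nhds (show 1 < 1 + e by linarith))] with σ h1 h2 h3
  have h1 := EReal.coe_lt_coe_iff.1 h1
  rw [EReal.coe_le_coe_iff]
  have h3 : v σ < 1 + e := h3
  nlinarith

/-- exponent one -/
lemma exp_le_one {A : ℝ → ℝ} {α C : ℝ} (hA : Tendsto A atTop atTop)
    (h1 : limsup (fun σ : ℝ => ((A σ / σ : ℝ) : EReal)) atTop = C)
    (h2 : 0 < liminf (fun σ : ℝ => ((A σ / σ ^ α : ℝ) : EReal)) atTop) : α ≤ 1 := by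
  by_contra! hα
  obtain ⟨c, hc0, hc⟩ := EReal.lt_iff_exists_real_btwn.1 h2
  have hc0 : 0 < c := by exact_mod_cast hc0
  have h3 := eventually_lt_of_lt_liminf hc
  have h4 : ∀ᶠ σ : ℝ in atTop, ((A σ / σ : ℝ) : EReal) < ((C + 1 : ℝ) : EReal) := by
    refine eventually_lt_of_limsup_lt ?_
    rw [h1]; exact EReal.coe_lt_coe_iff.2 (by linarith)
  have h5 : Tendsto (fun σ : ℝ => c * σ ^ (α - 1)) atTop atTop :=
    (tendsto_rpow_atTop (by linarith)).const_mul_atTop hc0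
  obtain ⟨σ, h3, h4, h5, h0⟩ := (h3.and (h4.and ((h5.eventually (eventually_gt_atTop (C+1))).and
    (eventually_gt_atTop 0)))).exists
  have h3 := EReal.coe_lt_coe_iff.1 h3
  have h4 := EReal.coe_lt_coe_iff.1 h4
  rw [lt_div_iff₀ (Real.rpow_pos_of_pos h0 _)] at h3
  rw [div_lt_iff₀ h0] at h4
  rw [Real.rpow_sub_one h0.ne', mul_div_assoc', lt_div_iff₀ h0] at h5
  linarith

lemma one_le_exp {A : ℝ → ℝ} {α : ℝ} (hA : Tendsto A atTop atTop)
    (h1 : 0 < limsup (fun σ : ℝ => ((A σ / σ : ℝ) : EReal)) atTop)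
    (h2 : limsup (fun σ : ℝ => ((A σ / σ ^ α : ℝ) : EReal)) atTop < ⊤) : 1 ≤ α := by
  by_contra! hα
  obtain ⟨c, hc0, hc⟩ := EReal.lt_iff_exists_real_btwn.1 h1
  have hc0 : 0 < c := by exact_mod_cast hc0
  obtain ⟨C, hC, _⟩ := EReal.lt_iff_exists_real_btwn.1 h2
  have h4 := eventually_lt_of_limsup_lt hC
  have h3 := frequently_lt_of_lt_limsup (by isBoundedDefault) hc
  have h5 : Tendsto (fun σ : ℝ => c * σ ^ (1 - α)) atTop atTop :=
    (tendsto_rpow_atTop (by linarith)).const_mul_atTop hc0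
  obtain ⟨σ, h3, h4, h5, h0⟩ := (h3.and_eventually (h4.and ((h5.eventually (eventually_gt_atTop C)).and
    (eventually_gt_atTop 0)))).exists
  have h3 := EReal.coe_lt_coe_iff.1 h3
  have h4 := EReal.coe_lt_coe_iff.1 h4
  have hp := Real.rpow_pos_of_pos h0 α
  rw [div_lt_iff₀ hp] at h4
  rw [lt_div_iff₀ h0] at h3
  rw [Real.rpow_sub h0, Real.rpow_one, mul_div_assoc', lt_div_iff₀ hp] at h5
  linarith

lemma coe_toReal_of_pos {x : EReal} (h0 : 0 < x) (h1 : x < ⊤) : ((x.toReal : ℝ) : EReal) = x :=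
  EReal.coe_toReal h1.ne (ne_bot_of_gt h0)

lemma toReal_pos_of {x : EReal} (h0 : 0 < x) (h1 : x < ⊤) : 0 < x.toReal := by
  rw [← EReal.coe_lt_coe_iff, coe_toReal_of_pos h0 h1]; exact h0

lemma A_tendsto (k : ℕ) (f : VVDS E) (h : VVDS G) :
    Tendsto (fun σ => Real.log^[k] (h.Minv (f.M σ))) atTop atTop :=
  (logit_tendsto k).comp (h.Minv_tendsto_s14.comp f.M_tendsto_s14)

lemma zero_iff (f : VVDS E) (h : VVDS G) (m q : ℕ)
    (hf1 : (0 : EReal) < relRittLowerOrder m q f h)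
    (hf2 : relRittLowerOrder m q f h ≤ relRittOrder m q f h)
    (hf3 : relRittOrder m q f h < ⊤)
    (hDf1 : (0 : EReal) < relRittType m q f h)
    (hDf2 : relRittType m q f h < ⊤) : m = 0 ↔ q = 0 := by
  have hp := hf1.trans_le hf2
  have hα := toReal_pos_of hp hf3
  have hc := coe_toReal_of_pos hp hf3
  cases m with
  | zero =>
    cases q with
    | zero => simp
    | succ q =>
      exfalso
      refine contra1 (A_tendsto 0 f h) (logit_tendsto q) hα ?_ hDf1
      rw [hc]
      simp only [relRittOrder, Function.iterate_succ_apply']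
  | succ m =>
    cases q with
    | succ q => simp
    | zero =>
      exfalso
      refine contra2 (A_tendsto m f h) ?_ hDf2
      simpa only [relRittLowerOrder, Function.iterate_succ_apply', Function.iterate_zero, id] using hf1

theorem stmt_14_aux (f : VVDS E) (g : VVDS F) (h : VVDS G) (p q m : ℕ)
    (hf1 : (0 : EReal) < relRittLowerOrder m q f h)
    (hf2 : relRittLowerOrder m q f h ≤ relRittOrder m q f h)
    (hf3 : relRittOrder m q f h < ⊤)
    (hg1 : (0 : EReal) < relRittLowerOrder m p g h)
    (hg2 : relRittLowerOrder m p g h ≤ relRittOrder m p g h)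
    (hg3 : relRittOrder m p g h < ⊤)
    (hDf1 : (0 : EReal) < relRittType m q f h)
    (hDf2 : relRittType m q f h < ⊤)
    (hDbf1 : (0 : EReal) < relRittLowerType m q f h)
    (hDg1 : (0 : EReal) < relRittType m p g h)
    (hDg2 : relRittType m p g h < ⊤)
    (hDbg1 : (0 : EReal) < relRittLowerType m p g h)
    (htbg2 : relRittUpperWeakType m p g h < ⊤) :
    relRittLowerOrder m p g h = relRittOrder m p g h ∧
      (relRittOrder p q f g).toReal * (relRittOrder m p g h).toReal
        = (relRittOrder m q f h).toReal := by
  have z1 := zero_iff f h m q hf1 hf2 hf3 hDf1 hDf2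
  have z2 := zero_iff g h m p hg1 hg2 hg3 hDg1 hDg2
  have hαp := toReal_pos_of (hf1.trans_le hf2) hf3
  have hα := coe_toReal_of_pos (hf1.trans_le hf2) hf3
  have hβp := toReal_pos_of (hg1.trans_le hg2) hg3
  have hβ := coe_toReal_of_pos (hg1.trans_le hg2) hg3
  have hs : Tendsto (fun σ => g.Minv (f.M σ)) atTop atTop := A_tendsto 0 f g
  have hMM : ∀ᶠ σ in atTop, g.M (g.Minv (f.M σ)) = f.M σ := f.M_tendsto_s14.eventually g.M_Minv
  rcases Nat.eq_zero_or_pos m with hm | hm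
  · have hq := z1.1 hm
    have hp := z2.1 hm
    subst hm hq hp
    have a1 : (relRittOrder 0 0 f h).toReal = 1 := by
      apply le_antisymm
      · exact exp_le_one (A_tendsto 0 f h) hα.symm hDbf1
      · exact one_le_exp (A_tendsto 0 f h) (hf1.trans_le hf2) hDf2
    have b1 : (relRittOrder 0 0 g h).toReal = 1 := by
      apply le_antisymm
      · exact exp_le_one (A_tendsto 0 g h) hβ.symm hDbg1
      · exact one_le_exp (A_tendsto 0 g h) (hg1.trans_le hg2) hDg2
    have c1 : 1 ≤ (relRittLowerOrder 0 0 g h).toReal :=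
      one_le_exp (A_tendsto 0 g h) (hg1.trans_le hg2) htbg2
    have hlt := lt_of_le_of_lt hg2 hg3
    have c2 := coe_toReal_of_pos hg1 hlt
    rw [a1] at hα
    rw [b1] at hβ
    have c3 : relRittLowerOrder 0 0 g h = relRittOrder 0 0 g h := by
      refine le_antisymm hg2 ?_
      rw [← hβ, ← c2]
      exact EReal.coe_le_coe_iff.2 c1
    refine ⟨c3, ?_⟩
    rw [a1, b1, mul_one]
    have hB : Tendsto (fun s => h.Minv (g.M s) / s) atTop (𝓝 1) := by
      refine EReal.tendsto_coe.1 (tendsto_of_le_liminf_of_limsup_le (le_of_eq ?_) (le_of_eq ?_))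
      · rw [hβ, ← c3]; rfl
      · rw [hβ]; rfl
    have hv := hB.comp hs
    have hv' := hv.inv₀ one_ne_zero
    rw [inv_one] at hv'
    have hApos := (A_tendsto 0 f h).eventually (eventually_gt_atTop 0)
    have hspos := hs.eventually (eventually_gt_atTop 0)
    have up : limsup (fun σ => ((h.Minv (f.M σ) / σ * (h.Minv (g.M (g.Minv (f.M σ))) / g.Minv (f.M σ))⁻¹ : ℝ) : EReal)) atTop ≤ ((1:ℝ) : EReal) := by
      refine limsup_mul_one ?_ hv' hα.symm
      filter_upwards [hApos, eventually_gt_atTop 0] with σ ha hσ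
      exact div_pos ha hσ
    have e1 : relRittOrder 0 0 f g ≤ ((1:ℝ) : EReal) := by
      refine le_trans (le_of_eq (limsup_congr ?_)) up
      filter_upwards [hApos, hspos, hMM, eventually_gt_atTop 0] with σ ha hs hM hσ
      have ha : 0 < h.Minv (f.M σ) := ha
      simp only [Function.iterate_zero, id, hM]
      congr 1
      field_simp
    have e0 : (0 : EReal) ≤ relRittOrder 0 0 f g := by
      refine le_limsup_of_frequently_le (Eventually.frequently ?_) (by isBoundedDefault)
      filter_upwards [hspos, eventually_gt_atTop 0] with σ hs hσ
      exact EReal.coe_nonneg.2 (div_nonneg hs.le hσ.le)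
    have e2 : (((relRittOrder 0 0 f g).toReal : ℝ) : EReal) = relRittOrder 0 0 f g :=
      EReal.coe_toReal (ne_top_of_le_ne_top (EReal.coe_ne_top 1) e1)
        (ne_bot_of_le_ne_bot (by simp) e0)
    have lo := limsup_mul_one (u := fun σ => g.Minv (f.M σ) / σ) (c := (relRittOrder 0 0 f g).toReal)
      (by
        filter_upwards [hspos, eventually_gt_atTop 0] with σ ha hσ
        exact div_pos ha hσ) hv e2.symm
    have e3 : ((1:ℝ) : EReal) ≤ relRittOrder 0 0 f g := by
      rw [← e2, hα]
      refine le_trans (le_of_eq (limsup_congr ?_)) lo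
      filter_upwards [hspos, hMM, eventually_gt_atTop 0] with σ hs hM hσ
      simp only [Function.iterate_zero, id, Function.comp, hM]
      congr 1
      field_simp
    rw [le_antisymm e1 e3]
    simp
  · obtain ⟨m, rfl⟩ : ∃ k, m = k + 1 := ⟨m - 1, by omega⟩
    obtain ⟨q, rfl⟩ : ∃ k, q = k + 1 := ⟨q - 1, by omega⟩
    obtain ⟨p, rfl⟩ : ∃ k, p = k + 1 := ⟨p - 1, by omega⟩
    have rf := regular (A_tendsto m f h) (logit_tendsto q) (α := (relRittOrder (m+1) (q+1) f h).toReal)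
      (by rw [hα]; simp only [relRittOrder, Function.iterate_succ_apply']) hDbf1
    have rg := regular (A_tendsto m g h) (logit_tendsto p) (α := (relRittOrder (m+1) (p+1) g h).toReal)
      (by rw [hβ]; simp only [relRittOrder, Function.iterate_succ_apply']) hDbg1
    constructor
    · rw [← hβ]
      have := ((continuous_coe_real_ereal.tendsto _).comp rg).liminf_eq
      rw [← this]
      simp only [relRittLowerOrder, Function.iterate_succ_apply', Function.comp_def]
    · have hd := rf.div (rg.comp hs) hβp.ne'
      have hd2 : Tendsto (fun σ => Real.log^[p+1] (g.Minv (f.M σ)) / Real.log^[q+1] σ) atTop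
          (𝓝 ((relRittOrder (m+1) (q+1) f h).toReal / (relRittOrder (m+1) (p+1) g h).toReal)) := by
        refine hd.congr' ?_
        have hl := (Real.tendsto_log_atTop.comp (A_tendsto m f h)).eventually (eventually_gt_atTop 0)
        filter_upwards [hl, hMM] with σ hl hM
        have hl : 0 < Real.log (Real.log^[m] (h.Minv (f.M σ))) := hl
        simp only [Function.iterate_succ_apply', Function.comp, Pi.div_apply, hM]
        rw [div_div_div_eq, mul_comm, mul_div_mul_right _ _ hl.ne']
      have := ((continuous_coe_real_ereal.tendsto _).comp hd2).limsup_eq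
      have e : relRittOrder (p+1) (q+1) f g = (((relRittOrder (m+1) (q+1) f h).toReal / (relRittOrder (m+1) (p+1) g h).toReal : ℝ) : EReal) := this
      rw [e, EReal.toReal_coe, div_mul_cancel₀ _ hβp.ne']

theorem stmt_14 (f : VVDS E) (g : VVDS F) (h : VVDS G) (p q m : ℕ)
    (hf1 : (0 : EReal) < relRittLowerOrder m q f h)
    (hf2 : relRittLowerOrder m q f h ≤ relRittOrder m q f h)
    (hf3 : relRittOrder m q f h < ⊤)
    (hg1 : (0 : EReal) < relRittLowerOrder m p g h)
    (hg2 : relRittLowerOrder m p g h ≤ relRittOrder m p g h)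
    (hg3 : relRittOrder m p g h < ⊤)
    (hDf1 : (0 : EReal) < relRittType m q f h)
    (hDf2 : relRittType m q f h < ⊤)
    (hDbf1 : (0 : EReal) < relRittLowerType m q f h)
    (hDbf2 : relRittLowerType m q f h < ⊤)
    (hDg1 : (0 : EReal) < relRittType m p g h)
    (hDg2 : relRittType m p g h < ⊤)
    (hDbg1 : (0 : EReal) < relRittLowerType m p g h)
    (hDbg2 : relRittLowerType m p g h < ⊤)
    (htbg1 : (0 : EReal) < relRittUpperWeakType m p g h)
    (htbg2 : relRittUpperWeakType m p g h < ⊤)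
    :
    (((((relRittLowerType m q f h).toReal / (relRittUpperWeakType m p g h).toReal) ^ (1 / (relRittLowerOrder m p g h).toReal)) : ℝ) : EReal) ≤ relRittLowerType p q f g ∧ relRittLowerType p q f g ≤ ((min (((relRittLowerType m q f h).toReal / (relRittLowerType m p g h).toReal) ^ (1 / (relRittOrder m p g h).toReal)) (((relRittType m q f h).toReal / (relRittType m p g h).toReal) ^ (1 / (relRittOrder m p g h).toReal)) : ℝ) : EReal) := by
  obtain ⟨e1, e2⟩ := stmt_14_aux f g h p q m hf1 hf2 hf3 hg1 hg2 hg3 hDf1 hDf2 hDbf1 hDg1 hDg2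
    hDbg1 htbg2
  have e3 : relRittUpperWeakType m p g h = relRittType m p g h := by
    unfold relRittUpperWeakType relRittType
    rw [e1]
  rw [e3, e1]
  have hβp := toReal_pos_of (hg1.trans_le hg2) hg3
  have hfM := f.M_tendsto_s14
  have hgM := g.M_tendsto_s14
  refine core (A := fun σ => Real.log^[m-1] (h.Minv (f.M σ)))
    (B := fun σ => Real.log^[m-1] (h.Minv (g.M σ))) (r := fun t => f.Minv (g.M t)) hβp e2
    (logit_tendsto (q-1)) (logit_tendsto (p-1)) (logit_mono (p-1))
    (s := fun σ => g.Minv (f.M σ)) (A_tendsto 0 f g) (A_tendsto 0 g f) ?_ ?_ ?_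
    (toReal_pos_of hDf1 hDf2) (toReal_pos_of hDbf1 hDbf2) (toReal_pos_of hDg1 hDg2)
    (toReal_pos_of hDbg1 hDbg2) (coe_toReal_of_pos hDf1 hDf2).symm
    (coe_toReal_of_pos hDbf1 hDbf2).symm (coe_toReal_of_pos hDg1 hDg2).symm
    (coe_toReal_of_pos hDbg1 hDbg2).symm
  · filter_upwards [hfM.eventually g.M_Minv] with σ h1
    rw [h1]
  · filter_upwards [hgM.eventually f.M_Minv, g.Minv_M_le] with t h1 h2
    rw [h1]; exact h2
  · filter_upwards [hgM.eventually f.M_Minv] with t h1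
    rw [h1]
end
end
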